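/- If k ≤ L, then every jammed configuration of non-overlapping horizontal or vertical k-mers on the L × L torus contains at least one wrapping cluster. -/

import Mathlib

/-- A horizontal k-mer on the `L × L` torus with parent site `(x, y)`. -/
def hKmer (L k : ℕ) (x y : ZMod L) : Set (ZMod L × ZMod L) :=
  {s | ∃ j : ℕ, j < k ∧ s = (x + (j : ZMod L), y)}

/-- A vertical k-mer on the `L × L` torus with parent site `(x, y)`. -/
def vKmer (L k : ℕ) (x y : ZMod L) : Set (ZMod L × ZMod L) :=
  {s | ∃ j : ℕ, j < k ∧ s = (x, y + (j : ZMod L))}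

/-- A set of sites is a (horizontal or vertical) k-mer. -/
def IsKmer (L k : ℕ) (m : Set (ZMod L × ZMod L)) : Prop :=
  ∃ x y : ZMod L, m = hKmer L k x y ∨ m = vKmer L k x y

/-- A configuration: a family of pairwise disjoint k-mers. -/
def IsConfig (L k : ℕ) (C : Set (Set (ZMod L × ZMod L))) : Prop :=
  (∀ m ∈ C, IsKmer L k m) ∧ C.Pairwise Disjoint

/-- A jammed configuration: no further k-mer fits entirely on empty sites. -/
def IsJammed (L k : ℕ) (C : Set (Set (ZMod L × ZMod L))) : Prop :=
  IsConfig L k C ∧ ∀ m, IsKmer L k m → ¬ Disjoint m (⋃₀ C)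

/-- Toroidal nearest-neighbor adjacency. -/
def Adj (L : ℕ) (a b : ZMod L × ZMod L) : Prop :=
  b - a ∈ ({((1 : ZMod L), (0 : ZMod L)), (-1, 0), (0, 1), (0, -1)} :
    Set (ZMod L × ZMod L))

/-- `Cl` is a cluster (connected component) of the set `occ` of occupied sites. -/
def IsCluster (L : ℕ) (occ Cl : Set (ZMod L × ZMod L)) : Prop :=
  ∃ a ∈ occ, Cl =
    {b | b ∈ occ ∧ Relation.ReflTransGen (fun p q => p ∈ occ ∧ q ∈ occ ∧ Adj L p q) a b}

/-- Reduction of an integer vector modulo `L` in both coordinates. -/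
def castPair (L : ℕ) (v : ℤ × ℤ) : ZMod L × ZMod L := ((v.1 : ZMod L), (v.2 : ZMod L))

/-- Unit steps in `ℤ²`. -/
def IsUnitStep (v : ℤ × ℤ) : Prop := v = (1, 0) ∨ v = (-1, 0) ∨ v = (0, 1) ∨ v = (0, -1)

/-- `S` wraps around the torus: it contains a closed nearest-neighbor walk whose
net winding vector (sum of the `ℤ²` lifts of its steps) is nonzero. -/
def Wraps (L : ℕ) (S : Set (ZMod L × ZMod L)) : Prop :=
  ∃ (x : ZMod L × ZMod L) (n : ℕ) (d : Fin n → ℤ × ℤ),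
    (∀ i, IsUnitStep (d i)) ∧
    (∀ m : ℕ, m ≤ n → x + castPair L (∑ i : Fin n, if (i : ℕ) < m then d i else 0) ∈ S) ∧
    castPair L (∑ i, d i) = 0 ∧ (∑ i, d i) ≠ 0

/-- The planar obstruction: a finite nonempty set `K` of cells, covered by horizontal needles `H a y`
and vertical needles `V x b` of length `k` which cross only if `k = 1`, and absorbing every
neighbouring cell of `O`, leaves room for a needle outside `O`. -/
lemma no_finite_jammed_component (k : ℕ) (hk : 0 < k) (O K : Set (ℤ × ℤ)) (H V : ℤ → ℤ → Prop)
    (hfin : K.Finite) (hne : K.Nonempty)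
    (jamH : ∀ a y : ℤ, ∃ x, a ≤ x ∧ x < a + k ∧ (x, y) ∈ O)
    (jamV : ∀ x b : ℤ, ∃ y, b ≤ y ∧ y < b + k ∧ (x, y) ∈ O)
    (absorb : ∀ v ∈ K, ∀ w ∈ O, IsUnitStep (w - v) → w ∈ K)
    (cover : ∀ x y : ℤ, (x, y) ∈ K →
      (∃ a, H a y ∧ a ≤ x ∧ x < a + k ∧ ∀ x', a ≤ x' → x' < a + k → (x', y) ∈ K) ∨
      (∃ b, V x b ∧ b ≤ y ∧ y < b + k ∧ ∀ y', b ≤ y' → y' < b + k → (x, y') ∈ K))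
    (cross : ∀ a y x b, H a y → V x b → a ≤ x → x < a + k → b ≤ y → y < b + k → k = 1) :
    False := by
  -- the tops of vertical needles that no cell of `K` further to the right exceeds in height
  let P : Set (ℤ × ℤ) := {p | V p.1 (p.2 - k + 1) ∧
    (∀ y', p.2 - k + 1 ≤ y' → y' ≤ p.2 → (p.1, y') ∈ K) ∧
    ∀ q ∈ K, p.1 < q.1 → q.2 ≤ p.2}
  have hPK : P ⊆ K := fun p hp => hp.2.1 p.2 (by omega) le_rfl
  have hPne : P.Nonempty := by
    obtain ⟨⟨x, y⟩, hxy, hmax⟩ := Set.exists_max_image K Prod.snd hfin hne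
    rcases cover x y hxy with ⟨a, -, -, -, haK⟩ | ⟨b, hV, hb1, hb2, hbK⟩
    · obtain ⟨x', h1, h2, hO⟩ := jamH a (y + 1)
      have := hmax _ (absorb _ (haK x' h1 h2) _ hO (by simp [IsUnitStep]))
      simp at this
    · have hb : b + k - 1 ≤ y := hmax _ (hbK (b + k - 1) (by omega) (by omega))
      have hb' : b = y - k + 1 := by omega
      subst hb'
      exact ⟨(x, y), hV, fun y' h1 h2 => hbK y' h1 (by dsimp only at h2; omega),
        fun q hq _ => hmax q hq⟩
  obtain ⟨⟨x, y⟩, ⟨hV, hVK, hright⟩, hxmax⟩ :=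
    Set.exists_max_image P Prod.fst (hfin.subset hPK) hPne
  dsimp only at hV hVK hright hxmax
  obtain ⟨z, hz1, hz2, hzO⟩ := jamV (x + 1) (y - k + 1)
  have hzK : (x + 1, z) ∈ K :=
    absorb _ (hVK z hz1 (by omega)) _ hzO (by simp [IsUnitStep])
  obtain ⟨⟨x', y'⟩, ⟨hK', hx'⟩, hmax⟩ := Set.exists_max_image {q ∈ K | x < q.1} Prod.snd
    (hfin.subset (Set.sep_subset _ _)) ⟨_, hzK, by simp⟩
  dsimp only at hx' hmax
  have hzy : z ≤ y' := hmax _ ⟨hzK, by simp⟩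
  have hyy : y' ≤ y := hright _ hK' hx'
  rcases cover x' y' hK' with ⟨a, hH, ha1, ha2, haK⟩ | ⟨b, hV', hb1, hb2, hbK⟩
  · have hxa : x < a := by
      by_contra! hax
      have := cross a y' x _ hH hV hax (by omega) (by omega) (by omega)
      omega
    obtain ⟨w, h1, h2, hO⟩ := jamH a (y' + 1)
    have := hmax _ ⟨absorb _ (haK w h1 h2) _ hO (by simp [IsUnitStep]), hxa.trans_le h1⟩
    simp at this
  · have hb : b + k - 1 ≤ y' := hmax _ ⟨hbK (b + k - 1) (by omega) (by omega), hx'⟩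
    have hb' : b = y' - k + 1 := by omega
    subst hb'
    have := hxmax (x', y') ⟨hV', fun t h1 h2 => hbK t h1 (by dsimp only at h2; omega),
      fun q hq hlt => hmax q ⟨hq, hx'.trans hlt⟩⟩
    dsimp only at this
    omega

/-- Two points joined by a chain of `r`-steps are joined by a sequence of such steps. -/
lemma exists_seq_of_reflTransGen {α : Type*} {r : α → α → Prop} {v w : α}
    (h : Relation.ReflTransGen r v w) :
    ∃ (n : ℕ) (f : ℕ → α), f 0 = v ∧ f n = w ∧ ∀ i < n, r (f i) (f (i + 1)) := by
  induction h using Relation.ReflTransGen.head_induction_on with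
  | refl => exact ⟨0, fun _ => w, rfl, rfl, by simp⟩
  | @head a c hac _ ih =>
    obtain ⟨n, f, h0, hn, hf⟩ := ih
    refine ⟨n + 1, fun i => i.casesOn a f, rfl, hn, ?_⟩
    rintro (_ | i) hi
    · simpa [h0] using hac
    · exact hf i (by omega)

lemma castPair_sub (L : ℕ) (v w : ℤ × ℤ) : castPair L (v - w) = castPair L v - castPair L w := by
  simp [castPair]

lemma castPair_surjective (L : ℕ) : Function.Surjective (castPair L) := fun p => by
  obtain ⟨a, ha⟩ := ZMod.intCast_surjective p.1
  obtain ⟨b, hb⟩ := ZMod.intCast_surjective p.2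
  exact ⟨(a, b), Prod.ext ha hb⟩

lemma IsUnitStep.adj {L : ℕ} {v w : ℤ × ℤ} (h : IsUnitStep (w - v)) :
    Adj L (castPair L v) (castPair L w) := by
  unfold Adj
  rw [← castPair_sub]
  rcases h with h | h | h | h <;> rw [h] <;> simp [castPair]

/-- A unit step between two lifted occupied sites. -/
def LiftStep (L : ℕ) (occ : Set (ZMod L × ZMod L)) (p q : ℤ × ℤ) : Prop :=
  castPair L p ∈ occ ∧ castPair L q ∈ occ ∧ IsUnitStep (q - p)

instance (L : ℕ) (occ : Set (ZMod L × ZMod L)) : Std.Symm (LiftStep L occ) where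
  symm p q := by
    rintro ⟨hp, hq, h⟩
    refine ⟨hq, hp, ?_⟩
    rw [← neg_sub]
    rcases h with h | h | h | h <;> rw [h] <;> simp [IsUnitStep]

lemma wraps_of_liftStep_chain {L : ℕ} {occ : Set (ZMod L × ZMod L)} {v w : ℤ × ℤ}
    (hv : castPair L v ∈ occ) (hne : v ≠ w) (hcast : castPair L v = castPair L w)
    (h : Relation.ReflTransGen (LiftStep L occ) v w) :
    ∃ Cl : Set (ZMod L × ZMod L), IsCluster L occ Cl ∧ Wraps L Cl := by
  obtain ⟨n, f, rfl, rfl, hf⟩ := exists_seq_of_reflTransGen h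
  have hpart : ∀ m ≤ n,
      (∑ i : Fin n, if (i : ℕ) < m then f (i + 1) - f i else 0) = f m - f 0 := by
    intro m hm
    rw [Fin.sum_univ_eq_sum_range (fun i => if i < m then f (i + 1) - f i else 0) n,
      ← Finset.sum_range_sub, ← Finset.sum_filter]
    congr 1
    ext i
    simp only [Finset.mem_filter, Finset.mem_range]
    omega
  have htotal : ∑ i : Fin n, (f (i + 1) - f i) = f n - f 0 := by
    simpa using hpart n le_rfl
  refine ⟨_, ⟨castPair L (f 0), hv, rfl⟩, castPair L (f 0), n, fun i => f (i + 1) - f i,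
    fun i => (hf i i.2).2.2, ?_, ?_, ?_⟩
  · intro m hm
    rw [hpart m hm, castPair_sub, add_sub_cancel]
    induction m with
    | zero => exact ⟨hv, .refl⟩
    | succ m ih =>
      obtain ⟨h1, h2, h3⟩ := hf m hm
      exact ⟨h2, (ih (by omega)).2.tail ⟨h1, h2, h3.adj⟩⟩
  · rw [htotal, castPair_sub, hcast, sub_self]
  · rw [htotal, sub_ne_zero]
    exact hne.symm

/-- A set of lifted occupied sites closed under `LiftStep` contains every straight segment of lifted
occupied sites that it meets. -/
lemma segment_subset {K O : Set (ℤ × ℤ)} (absorb : ∀ v ∈ K, ∀ w ∈ O, IsUnitStep (w - v) → w ∈ K)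
    (g : ℤ → ℤ × ℤ) (hg : ∀ i, IsUnitStep (g (i + 1) - g i) ∧ IsUnitStep (g i - g (i + 1)))
    {a c s : ℤ} (hO : ∀ i, a ≤ i → i < c → g i ∈ O) (hs : g s ∈ K) (has : a ≤ s) (hsc : s < c) :
    ∀ i, a ≤ i → i < c → g i ∈ K := by
  have up : ∀ i, s ≤ i → i < c → g i ∈ K := fun i hi => by
    induction i, hi using Int.leInduction with
    | base => exact fun _ => hs
    | succ i hi ih =>
      exact fun hic => absorb _ (ih (by omega)) _ (hO _ (by omega) hic) (hg i).1
  have down : ∀ i, i ≤ s → a ≤ i → g i ∈ K := fun i hi => by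
    induction i, hi using Int.leInductionDown with
    | base => exact fun _ => hs
    | pred i hi ih =>
      intro hai
      have := (hg (i - 1)).2
      rw [sub_add_cancel] at this
      exact absorb _ (ih (by omega)) _ (hO _ hai (by omega)) this
  intro i h1 h2
  rcases le_total s i with h | h
  · exact up i h h2
  · exact down i h h1

lemma castPair_mem_hKmer {L k : ℕ} {a x y : ℤ} (h1 : a ≤ x) (h2 : x < a + k) :
    castPair L (x, y) ∈ hKmer L k a y := by
  refine ⟨(x - a).toNat, by omega, ?_⟩
  have : (((x - a).toNat : ℤ) : ZMod L) = ((x - a : ℤ) : ZMod L) := by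
    rw [Int.toNat_of_nonneg (by omega)]
  push_cast at this
  simp [castPair, this]

lemma castPair_mem_vKmer {L k : ℕ} {x b y : ℤ} (h1 : b ≤ y) (h2 : y < b + k) :
    castPair L (x, y) ∈ vKmer L k x b := by
  refine ⟨(y - b).toNat, by omega, ?_⟩
  have : (((y - b).toNat : ℤ) : ZMod L) = ((y - b : ℤ) : ZMod L) := by
    rw [Int.toNat_of_nonneg (by omega)]
  push_cast at this
  simp [castPair, this]

/-- If a horizontal and a vertical `k`-mer of a configuration meet, then `k = 1`. -/
lemma IsConfig.eq_one_of_cross {L k : ℕ} (hkL : k ≤ L) {C : Set (Set (ZMod L × ZMod L))}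
    (hC : IsConfig L k C) {a y x b : ℤ} (hH : hKmer L k a y ∈ C) (hV : vKmer L k x b ∈ C)
    (h1 : a ≤ x) (h2 : x < a + k) (h3 : b ≤ y) (h4 : y < b + k) : k = 1 := by
  by_contra hk1
  have heq : hKmer L k a y = vKmer L k x b := by
    by_contra hne
    exact Set.disjoint_left.mp (hC.2 hH hV hne) (castPair_mem_hKmer h1 h2)
      (castPair_mem_vKmer h3 h4)
  have key : ∀ t : ℤ, a ≤ t → t < a + k → (t : ZMod L) = x := by
    intro t ht1 ht2
    have hmem : castPair L (t, y) ∈ hKmer L k a y := castPair_mem_hKmer ht1 ht2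
    rw [heq] at hmem
    obtain ⟨j, -, hj⟩ := hmem
    exact congrArg Prod.fst hj
  have h := (key (a + 1) (by omega) (by omega)).trans (key a le_rfl (by omega)).symm
  have h10 : ((1 : ℕ) : ZMod L) = 0 := by simpa using h
  rw [ZMod.natCast_eq_zero_iff, Nat.dvd_one] at h10
  omega

/-- If `k ≤ L`, every jammed configuration of non-overlapping horizontal or
vertical k-mers on the `L × L` torus contains at least one wrapping cluster. -/
theorem jammed_has_wrapping_cluster (L k : ℕ) (hL : 0 < L) (hk : 0 < k) (hkL : k ≤ L)
    (C : Set (Set (ZMod L × ZMod L))) (hC : IsJammed L k C) :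
    ∃ Cl : Set (ZMod L × ZMod L), IsCluster L (⋃₀ C) Cl ∧ Wraps L Cl := by
  have : NeZero L := ⟨hL.ne'⟩
  obtain ⟨hconf, hjam⟩ := hC
  obtain ⟨p, -, hp⟩ := Set.not_disjoint_iff.mp (hjam (hKmer L k 0 0) ⟨0, 0, .inl rfl⟩)
  obtain ⟨v₀, rfl⟩ := castPair_surjective L p
  let O : Set (ℤ × ℤ) := castPair L ⁻¹' ⋃₀ C
  let K : Set (ℤ × ℤ) := {v | Relation.ReflTransGen (LiftStep L (⋃₀ C)) v₀ v}
  have hKO : K ⊆ O := fun v hv => by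
    rcases Relation.ReflTransGen.cases_tail hv with rfl | ⟨w, -, hw⟩
    · exact hp
    · exact hw.2.1
  have absorb : ∀ v ∈ K, ∀ w ∈ O, IsUnitStep (w - v) → w ∈ K := fun v hv w hw h =>
    Relation.ReflTransGen.tail hv ⟨hKO hv, hw, h⟩
  by_cases hinj : Set.InjOn (castPair L) K
  · exfalso
    refine no_finite_jammed_component k hk O K (fun a y => hKmer L k a y ∈ C)
      (fun x b => vKmer L k x b ∈ C)
      (Set.Finite.of_injOn (Set.mapsTo_univ _ _) hinj Set.finite_univ) ⟨v₀, .refl⟩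
      ?_ ?_ absorb ?_ ?_
    · intro a y
      obtain ⟨_, ⟨j, hj, rfl⟩, hs⟩ :=
        Set.not_disjoint_iff.mp (hjam (hKmer L k a y) ⟨a, y, .inl rfl⟩)
      exact ⟨a + j, by omega, by omega, by simpa [O, castPair] using hs⟩
    · intro x b
      obtain ⟨_, ⟨j, hj, rfl⟩, hs⟩ :=
        Set.not_disjoint_iff.mp (hjam (vKmer L k x b) ⟨x, b, .inr rfl⟩)
      exact ⟨b + j, by omega, by omega, by simpa [O, castPair] using hs⟩
    · intro x y hxy
      obtain ⟨m, hm, hxm⟩ := hKO hxy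
      obtain ⟨a, b, rfl | rfl⟩ := hconf.1 m hm
      · left
        obtain ⟨j, hj, hs⟩ := hxm
        obtain ⟨hx, hy⟩ := Prod.ext_iff.mp hs
        obtain rfl : ((x - j : ℤ) : ZMod L) = a := by
          simp only [castPair] at hx
          simp [hx]
        obtain rfl : (y : ZMod L) = b := hy
        refine ⟨x - j, hm, by omega, by omega, ?_⟩
        exact segment_subset absorb (fun i => (i, y)) (fun i => by simp [IsUnitStep])
          (fun i h1 h2 => ⟨_, hm, castPair_mem_hKmer h1 h2⟩) hxy (by omega) (by omega)
      · right
        obtain ⟨j, hj, hs⟩ := hxm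
        obtain ⟨hx, hy⟩ := Prod.ext_iff.mp hs
        obtain rfl : ((y - j : ℤ) : ZMod L) = b := by
          simp only [castPair] at hy
          simp [hy]
        obtain rfl : (x : ZMod L) = a := hx
        refine ⟨y - j, hm, by omega, by omega, ?_⟩
        exact segment_subset absorb (fun i => (x, i)) (fun i => by simp [IsUnitStep])
          (fun i h1 h2 => ⟨_, hm, castPair_mem_vKmer h1 h2⟩) hxy (by omega) (by omega)
    · exact fun a y x b hH hV => hconf.eq_one_of_cross hkL hH hV
  · simp only [Set.InjOn] at hinj
    push Not at hinj
    obtain ⟨v, hv, w, hw, hvw, hne⟩ := hinj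
    have hsymm : Relation.ReflTransGen (LiftStep L (⋃₀ C)) v v₀ :=
      Relation.ReflTransGen.stdSymm.symm _ _ hv
    exact wraps_of_liftStep_chain (hKO hv) hne hvw (hsymm.trans hw)
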